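/- Let (α₀, α₁, α₂, α₃) be a rotation quadrangle with relative revolute axes r_{i,i+1}, and let u be a line, distinct from each axis r_{i,i+1}, that meets each axis r_{i,i+1} in a point P_{i,i+1} such that the four points P₀₁, P₁₂, P₂₃, P₃₀ are pairwise distinct. Then for every point X of u the four homologous images α₀(X), α₁(X), α₂(X), α₃(X) lie on a circle or line. -/

import Mathlib

noncomputable section

abbrev E : Type := EuclideanSpace ℝ (Fin 3)

/-- A line: a one-dimensional affine subspace. -/
def IsLine (s : AffineSubspace ℝ E) : Prop := Module.finrank ℝ s.direction = 1

/-- A plane: a two-dimensional affine subspace. -/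
def IsPlane (s : AffineSubspace ℝ E) : Prop := Module.finrank ℝ s.direction = 2

/-- A set of points lies on a circle or a line: it is concyclic (contained in the
intersection of a sphere and a plane) or collinear. -/
def ConcyclicOrCollinear (s : Set E) : Prop :=
  EuclideanGeometry.Concyclic s ∨ Collinear ℝ s

/-- `τ` is a rotation with axis `r`: an isometry different from the identity whose
linear part has determinant 1 and which fixes every point of the line `r`. -/
def IsRotation (τ : E ≃ᵃⁱ[ℝ] E) (r : AffineSubspace ℝ E) : Prop :=
  τ ≠ AffineIsometryEquiv.refl ℝ E ∧
  LinearMap.det (τ.linearIsometryEquiv.toLinearEquiv : E →ₗ[ℝ] E) = 1 ∧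
  IsLine r ∧ ∀ x ∈ r, τ x = x

/-- `(α 0, α 1, α 2, α 3)` is a rotation quadrangle with relative revolute axes
`r i` (in the moving space): each relative displacement `τ_{i,i+1} = α (i+1) ∘ (α i)⁻¹`
is a rotation whose axis is the image `α i (r i)`. -/
def IsRotationQuadrangle (α : Fin 4 → (E ≃ᵃⁱ[ℝ] E)) (r : Fin 4 → AffineSubspace ℝ E) : Prop :=
  ∀ i : Fin 4,
    IsRotation ((α i).symm.trans (α (i + 1)))
      ((r i).map (α i).toAffineIsometry.toAffineMap)

open scoped RealInnerProductSpace in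
/-- Step: if `e ⬝ (A + B) = 2 e ⬝ m` and `B - A` is parallel to `e`, then `A`, `B` are
equidistant from `m`. -/
theorem dist_eq_aux (A B e m : E) (p : ℝ) (h : B = A - p • e)
    (hm : ⟪e, A + B⟫ = 2 * ⟪e, m⟫) : dist B m = dist A m := by
  rw [dist_eq_norm, dist_eq_norm, ← sq_eq_sq₀ (norm_nonneg _) (norm_nonneg _)]
  have h1 : B - m = (A - m) - p • e := by rw [h]; abel
  have h2 : A + B = (2:ℝ) • (A - m) - p • e + (2:ℝ) • m := by rw [h]; module
  rw [h2, inner_add_right, inner_sub_right, inner_smul_right, inner_smul_right,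
    inner_smul_right, real_inner_self_eq_norm_sq] at hm
  rw [h1, norm_sub_sq_real, norm_smul, inner_smul_right, real_inner_comm, mul_pow,
    Real.norm_eq_abs, sq_abs]
  linear_combination (-p) * hm

open scoped RealInnerProductSpace in
theorem telescope_aux (A B d d' : E) (p : ℝ) (h : B = A - p • (d' - d)) (hd : ‖d'‖ = ‖d‖) :
    ⟪d' - d, A + B⟫ = 2 * ⟪d', B⟫ - 2 * ⟪d, A⟫ ∧
      p * ⟪d' - d, A + B⟫ = ‖A‖ ^ 2 - ‖B‖ ^ 2 := by
  have hd2 : ⟪d', d'⟫ = ⟪d, d⟫ := by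
    rw [real_inner_self_eq_norm_sq, real_inner_self_eq_norm_sq, hd]
  constructor
  · subst h
    simp only [inner_sub_left, inner_add_right, inner_sub_right, inner_smul_right]
    rw [real_inner_comm d d'] at *
    linear_combination p * hd2
  · have : ⟪A - B, A + B⟫ = ‖A‖ ^ 2 - ‖B‖ ^ 2 := by
      rw [inner_sub_left, inner_add_right, inner_add_right, real_inner_comm A B,
        real_inner_self_eq_norm_sq, real_inner_self_eq_norm_sq]
      ring
    rw [← this, ← real_inner_smul_left]
    congr 1
    rw [h]; abel

open scoped RealInnerProductSpace in
/-- Two independent linear conditions can be solved. -/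
theorem solve_aux (e f : E) (a b : ℝ) (he : e ≠ 0)
    (hw : ⟪e, e⟫ • f - ⟪e, f⟫ • e ≠ 0) : ∃ m : E, ⟪e, m⟫ = a ∧ ⟪f, m⟫ = b := by
  have h0 : ⟪e, e⟫ ≠ 0 := inner_self_ne_zero.mpr he
  set w := ⟪e, e⟫ • f - ⟪e, f⟫ • e with hwd
  have h1 : ⟪e, w⟫ = 0 := by
    rw [hwd, inner_sub_right, inner_smul_right, inner_smul_right]; ring
  have h2 : ⟪w, w⟫ ≠ 0 := inner_self_ne_zero.mpr hw
  have h3 : ⟪w, w⟫ = ⟪e, e⟫ * ⟪f, w⟫ := by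
    conv_lhs => rw [hwd]
    rw [← hwd, inner_sub_left, real_inner_smul_left, real_inner_smul_left, h1]; ring
  have h4 : ⟪f, w⟫ ≠ 0 := by
    intro h; apply h2; rw [h3, h, mul_zero]
  refine ⟨(a / ⟪e, e⟫) • e + ((b - a / ⟪e, e⟫ * ⟪f, e⟫) / ⟪f, w⟫) • w, ?_, ?_⟩
  · rw [inner_add_right, inner_smul_right, inner_smul_right, h1]; field_simp; ring
  · rw [inner_add_right, inner_smul_right, inner_smul_right]; field_simp; ring

theorem collinear_aux (s : Set E) (A v : E) (h : ∀ x ∈ s, ∃ c : ℝ, x = A + c • v) :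
    Collinear ℝ s := by
  rw [collinear_iff_exists_forall_eq_smul_vadd]
  refine ⟨A, v, fun x hx => ?_⟩
  obtain ⟨c, hc⟩ := h x hx
  exact ⟨c, by rw [hc, vadd_eq_add, add_comm]⟩

theorem coplanar_aux (s : Set E) (A v w : E)
    (h : ∀ x ∈ s, ∃ a b : ℝ, x = A + (a • v + b • w)) : Coplanar ℝ s := by
  have hle : vectorSpan ℝ s ≤ Submodule.span ℝ {v, w} := by
    rw [vectorSpan, Submodule.span_le]
    rintro _ ⟨x, hx, y, hy, rfl⟩
    obtain ⟨a, b, rfl⟩ := h x hx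
    obtain ⟨a', b', rfl⟩ := h y hy
    refine Submodule.mem_span_pair.mpr ⟨a - a', b - b', ?_⟩
    simp only [vsub_eq_sub]
    module
  refine (Submodule.rank_mono hle).trans ((rank_span_le _).trans ?_)
  have := Cardinal.mk_insert_le (s := ({w} : Set E)) (a := v)
  refine this.trans ?_
  rw [Cardinal.mk_singleton]
  norm_num

open scoped RealInnerProductSpace in
/-- Vector form of the theorem. -/
theorem core_aux (A d : Fin 4 → E) (p : Fin 4 → ℝ) (hp : p 3 ≠ p 2)
    (hd : ∀ i, ‖d (i + 1)‖ = ‖d i‖)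
    (h : ∀ i, A (i + 1) = A i - p i • (d (i + 1) - d i)) :
    ConcyclicOrCollinear (Set.range A) := by
  have h0 : A 1 = A 0 - p 0 • (d 1 - d 0) := h 0
  have h1 : A 2 = A 1 - p 1 • (d 2 - d 1) := h 1
  have h2 : A 3 = A 2 - p 2 • (d 3 - d 2) := h 2
  have h3 : A 0 = A 3 - p 3 • (d 0 - d 3) := h 3
  obtain ⟨s0, q0⟩ := telescope_aux _ _ _ _ _ h0 (hd 0)
  obtain ⟨s1, q1⟩ := telescope_aux _ _ _ _ _ h1 (hd 1)
  obtain ⟨s2, q2⟩ := telescope_aux _ _ _ _ _ h2 (hd 2)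
  obtain ⟨s3, q3⟩ := telescope_aux _ _ _ _ _ h3 (hd 3)
  have hp' : p 3 - p 2 ≠ 0 := sub_ne_zero.mpr hp
  set e0 := d 1 - d 0 with he0
  set e1 := d 2 - d 1 with he1
  set e2 := d 3 - d 2 with he2
  set e3 := d 0 - d 3 with he3
  have hsum : e2 = -(e0 + e1 + e3) := by rw [he0, he1, he2, he3]; abel
  have hsum2 : p 0 • e0 + p 1 • e1 + p 2 • e2 + p 3 • e3 = 0 := by
    have a0 : p 0 • e0 = A 0 - A 1 := by rw [h0]; abel
    have a1 : p 1 • e1 = A 1 - A 2 := by rw [h1]; abel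
    have a2 : p 2 • e2 = A 2 - A 3 := by rw [h2]; abel
    have a3 : p 3 • e3 = A 3 - A 0 := by
      have : A 3 - A 0 = A 3 - (A 3 - p 3 • e3) := by rw [← h3]
      rw [this]; abel
    rw [a0, a1, a2, a3]; abel
  have hmul : (p 3 - p 2) • e3 = (p 2 - p 0) • e0 + (p 2 - p 1) • e1 := by
    rw [hsum] at hsum2
    rw [← sub_eq_zero, ← hsum2]; module
  clear_value e0 e1 e2 e3
  obtain ⟨x, y, hx, hy⟩ : ∃ x y : ℝ, (p 3 - p 2) * x = p 2 - p 0 ∧ (p 3 - p 2) * y = p 2 - p 1 :=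
    ⟨(p 2 - p 0) / (p 3 - p 2), (p 2 - p 1) / (p 3 - p 2), by field_simp, by field_simp⟩
  have he : e3 = x • e0 + y • e1 := by
    apply smul_right_injective E hp'
    simp only
    rw [hmul, smul_add, smul_smul, smul_smul, hx, hy]
  have hA3 : A 3 = A 0 + p 3 • e3 := by
    conv_rhs => rw [h3]
    abel
  have hA2 : A 2 = A 0 - p 0 • e0 - p 1 • e1 := by rw [h1, h0]
  have hcol : ∀ v : E, (∃ a : ℝ, e0 = a • v) → (∃ b : ℝ, e1 = b • v) →
      Collinear ℝ (Set.range A) := by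
    rintro v ⟨a, ha⟩ ⟨b, hb⟩
    apply collinear_aux _ (A 0) v
    rintro _ ⟨i, rfl⟩
    fin_cases i
    · exact ⟨0, by simp⟩
    · exact ⟨-(p 0 * a), by simp only [Fin.mk_one]; rw [h0, ha]; module⟩
    · exact ⟨-(p 0 * a) - p 1 * b, by
        change A 2 = _
        rw [hA2, ha, hb]; module⟩
    · exact ⟨p 3 * (x * a + y * b), by
        change A 3 = _
        rw [hA3, he, ha, hb]; module⟩
  by_cases hz : e0 = 0
  · exact Or.inr (hcol e1 ⟨0, by rw [hz, zero_smul]⟩ ⟨1, (one_smul _ _).symm⟩)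
  by_cases hw : ⟪e0, e0⟫ • e1 - ⟪e0, e1⟫ • e0 = 0
  · refine Or.inr (hcol e0 ⟨1, (one_smul _ _).symm⟩ ⟨⟪e0, e1⟫ / ⟪e0, e0⟫, ?_⟩)
    have hn : ⟪e0, e0⟫ ≠ 0 := inner_self_ne_zero.mpr hz
    apply smul_right_injective E hn
    simp only
    rw [smul_smul, mul_div_cancel₀ _ hn]
    exact sub_eq_zero.mp hw
  left
  obtain ⟨m, m0, m1⟩ := solve_aux e0 e1 (⟪e0, A 0 + A 1⟫ / 2) (⟪e1, A 1 + A 2⟫ / 2) hz hw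
  have m3 : ⟪e3, A 3 + A 0⟫ = 2 * ⟪e3, m⟫ := by
    apply mul_left_cancel₀ hp'
    have : (p 3 - p 2) * ⟪e3, m⟫ = (p 2 - p 0) * ⟪e0, m⟫ + (p 2 - p 1) * ⟪e1, m⟫ := by
      rw [← real_inner_smul_left, hmul, inner_add_left, real_inner_smul_left,
        real_inner_smul_left]
    rw [m0, m1] at this
    linear_combination (-2) * this + q0 + q1 + q2 + q3 - p 2 * (s0 + s1 + s2 + s3)
  have D1 : dist (A 1) m = dist (A 0) m := dist_eq_aux _ _ e0 m _ h0 (by linarith)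
  have D2 : dist (A 2) m = dist (A 1) m := dist_eq_aux _ _ e1 m _ h1 (by linarith)
  have D3 : dist (A 0) m = dist (A 3) m := dist_eq_aux _ _ e3 m _ h3 (by linarith)
  refine ⟨⟨m, dist (A 0) m, ?_⟩, ?_⟩
  · rintro _ ⟨i, rfl⟩
    fin_cases i
    · rfl
    · exact D1
    · exact D2.trans D1
    · exact D3.symm
  · apply coplanar_aux _ (A 0) e0 e1
    rintro _ ⟨i, rfl⟩
    fin_cases i
    · exact ⟨0, 0, by simp⟩
    · exact ⟨-p 0, 0, by
        change A 1 = _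
        rw [h0]; module⟩
    · exact ⟨-p 0, -p 1, by
        change A 2 = _
        rw [hA2]; module⟩
    · exact ⟨p 3 * x, p 3 * y, by
        change A 3 = _
        rw [hA3, he]; module⟩

/-- In a rotation quadrangle, if a line `u`, distinct from the four
relative revolute axes, meets each axis `r i` in a point `P i` and these four points
are pairwise distinct, then the homologous images of every point of `u` lie on a
circle or line. -/
theorem homologous_images_of_transversal_point
    (α : Fin 4 → (E ≃ᵃⁱ[ℝ] E)) (r : Fin 4 → AffineSubspace ℝ E)
    (hquad : IsRotationQuadrangle α r)
    (u : AffineSubspace ℝ E) (hu : IsLine u) (hne : ∀ i, u ≠ r i)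
    (P : Fin 4 → E) (hPu : ∀ i, P i ∈ u) (hPr : ∀ i, P i ∈ r i)
    (hPdist : Function.Injective P) :
    ∀ X ∈ u, ConcyclicOrCollinear (Set.range fun j : Fin 4 => α j X) := by
  intro X hX
  obtain ⟨v, -, hv⟩ := finrank_eq_one_iff'.mp hu
  have hP : ∀ i, ∃ c : ℝ, P i = X + c • (v : E) := by
    intro i
    obtain ⟨c, hc⟩ := hv ⟨P i -ᵥ X, AffineSubspace.vsub_mem_direction (hPu i) hX⟩
    refine ⟨c, ?_⟩
    have : c • (v : E) = P i - X := congrArg Subtype.val hc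
    rw [this]; abel
  choose p hp using hP
  have hlin : ∀ i (c : ℝ), α i (X + c • (v : E)) =
      α i X + c • (α i).linearIsometryEquiv (v : E) := by
    intro i c
    have := (α i).map_vadd X (c • (v : E))
    rw [vadd_eq_add, vadd_eq_add, map_smul] at this
    rw [add_comm, this, add_comm]
  apply core_aux (fun j => α j X) (fun j => (α j).linearIsometryEquiv (v : E)) p
  · intro h
    have : P 3 = P 2 := by rw [hp, hp, h]
    exact absurd (hPdist this) (by decide)
  · intro i
    simp only [LinearIsometryEquiv.norm_map]
  · intro i
    have hfix := (hquad i).2.2.2 (α i (P i)) ⟨P i, hPr i, rfl⟩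
    have hfix' : α (i + 1) (P i) = α i (P i) := by
      simpa using hfix
    rw [hp i, hlin, hlin] at hfix'
    rw [eq_sub_of_add_eq hfix']
    module
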